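/- arXiv:1007.2261 — 2 statements merged into one kernel-verified Lean document; each statement's English description precedes it below -/
import Mathlib

section
/- Let R be a commutative ring and n ≥ 2. If g ∈ SL(n, R) can be written as g = L·D·U, where L ∈ SL(n, R) is lower triangular with all diagonal entries equal to 1, D ∈ SL(n, R) is diagonal, and U ∈ SL(n, R) is upper triangular with all diagonal entries equal to 1, then g is a product of at most n(n−1) + 4(n−1) elementary transvections eᵢⱼ(t). -/
/-- The elementary transvection `e i j t = 1 + t·Eᵢⱼ` as an element of `SL(n, R)`. -/
def elemTransvection {n : ℕ} {R : Type*} [CommRing R] (i j : Fin n) (hij : i ≠ j) (t : R) :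
    Matrix.SpecialLinearGroup (Fin n) R :=
  ⟨Matrix.transvection i j t, Matrix.det_transvection_of_ne i j hij t⟩

/-- `g ∈ SL(n, R)` is a product of at most `N` elementary transvections. -/
def IsProductOfElemTransvections {n : ℕ} {R : Type*} [CommRing R]
    (g : Matrix.SpecialLinearGroup (Fin n) R) (N : ℕ) : Prop :=
  ∃ L : List (Matrix.SpecialLinearGroup (Fin n) R),
    L.length ≤ N ∧
    (∀ x ∈ L, ∃ (i j : Fin n) (hij : i ≠ j) (t : R), x = elemTransvection i j hij t) ∧
    L.prod = g


open Matrix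

section

variable {n : ℕ} {R : Type*} [CommRing R]

namespace IsProductOfElemTransvections

lemma one (N : ℕ) : IsProductOfElemTransvections (1 : SpecialLinearGroup (Fin n) R) N :=
  ⟨[], by simp, by simp, rfl⟩

lemma mul {g h : SpecialLinearGroup (Fin n) R} {M N : ℕ}
    (hg : IsProductOfElemTransvections g M) (hh : IsProductOfElemTransvections h N) :
    IsProductOfElemTransvections (g * h) (M + N) := by
  obtain ⟨l, hl, hlt, rfl⟩ := hg
  obtain ⟨m, hm, hmt, rfl⟩ := hh
  refine ⟨l ++ m, by rw [List.length_append]; exact add_le_add hl hm, fun x hx ↦ ?_,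
    List.prod_append⟩
  exact (List.mem_append.1 hx).elim (hlt x) (hmt x)

lemma elemTransvection {i j : Fin n} (hij : i ≠ j) (t : R) :
    IsProductOfElemTransvections (_root_.elemTransvection i j hij t) 1 :=
  ⟨[_root_.elemTransvection i j hij t], by simp, by simpa using ⟨i, j, hij, t, rfl⟩, by simp⟩

end IsProductOfElemTransvections

lemma coe_elemTransvection {i j : Fin n} (hij : i ≠ j) (t : R) :
    (elemTransvection i j hij t : Matrix (Fin n) (Fin n) R) = transvection i j t :=
  rfl

lemma elemTransvection_neg_mul_cancel {i j : Fin n} (hij : i ≠ j) (t : R) :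
    elemTransvection i j hij (-t) * elemTransvection i j hij t = 1 := by
  ext a b
  simp [coe_elemTransvection, transvection_mul_transvection_same _ _ hij]

/-- A matrix with unit diagonal which is supported, off the diagonal, on a set `s` of positions
whose row is smaller than their column, for the order pulled back along `r`, is a product of
at most `#s` elementary transvections. -/
lemma isProductOfElemTransvections_of_unitriangular {α : Type*} [LinearOrder α] (r : Fin n → α)
    (s : Finset (Fin n × Fin n)) (hs : ∀ p ∈ s, r p.1 < r p.2)
    (A : SpecialLinearGroup (Fin n) R) (hdiag : ∀ i, A i i = 1)
    (hoff : ∀ i j, i ≠ j → (i, j) ∉ s → A i j = 0) :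
    IsProductOfElemTransvections A s.card := by
  induction s using Finset.induction_on_max_value (fun p : Fin n × Fin n ↦ r p.2) generalizing A with
  | empty =>
    have : A = 1 := by
      ext i j
      rcases eq_or_ne i j with rfl | h
      · simp [hdiag]
      · simp [h, hoff i j h]
    exact this ▸ .one _
  | insert p s hp hmax ih =>
    obtain ⟨i, j⟩ := p
    have hlt : r i < r j := hs (i, j) (Finset.mem_insert_self _ _)
    have hij : i ≠ j := fun h ↦ hlt.ne (congrArg r h)
    have hrow : ∀ k, j ≠ k → A j k = 0 := fun k hk ↦ hoff j k hk fun hmem ↦ by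
      have hjk := hs _ hmem
      rcases Finset.mem_insert.1 hmem with h | h
      · exact hij (Prod.ext_iff.1 h).1.symm
      · exact (hmax _ h).not_gt hjk
    set t := A i j with ht
    have hprod : A = elemTransvection i j hij t * (elemTransvection i j hij (-t) * A) := by
      rw [← mul_assoc, ← neg_neg t, neg_neg (-t), elemTransvection_neg_mul_cancel, one_mul]
    have hentry : ∀ a b, (elemTransvection i j hij (-t) * A) a b =
        if a = i then A i b - t * A j b else A a b := by
      intro a b
      rw [Matrix.SpecialLinearGroup.coe_mul, coe_elemTransvection]
      split_ifs with h
      · subst h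
        rw [transvection_mul_apply_same]; ring
      · exact transvection_mul_apply_of_ne _ _ _ _ h _ _
    rw [Finset.card_insert_of_notMem hp, add_comm, hprod]
    refine .mul (.elemTransvection hij t)
      (ih (fun p hp ↦ hs p (Finset.mem_insert_of_mem hp)) _ (fun a ↦ ?_) fun a b hab hmem ↦ ?_)
    · rw [hentry]
      split_ifs with h
      · rw [h, hrow i hij.symm, hdiag]; simp
      · exact hdiag a
    · rw [hentry]
      split_ifs with h
      · subst h
        by_cases hb : j = b
        · subst hb
          simp [hdiag, ht]
        · rw [hrow b hb, hoff a b hab]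
          · simp
          · simpa [Ne.symm hb] using hmem
      · refine hoff a b hab ?_
        simpa [h] using hmem

/-- The diagonal matrix with entries `u` and `v = u⁻¹` at `i` and `j`, and `1` elsewhere, as a
product of four transvections. -/
lemma transvection_mul_eq_diagonal {i j : Fin n} (hij : i ≠ j) {u v : R} (huv : u * v = 1) :
    transvection j i (-(v * (v - 1))) * transvection i j (-u) *
      transvection j i (v - 1) * transvection i j 1 =
    diagonal (fun k ↦ if k = i then u else if k = j then v else 1) := by
  simp only [transvection, mul_add, add_mul, mul_one, one_mul, add_zero, single_mul_single_same,
    single_mul_single_of_ne _ _ _ _ hij, single_mul_single_of_ne _ _ _ _ hij.symm]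
  ext a b
  simp only [Matrix.add_apply, single_apply, diagonal_apply, one_apply]
  split_ifs <;> grind

lemma Matrix.SpecialLinearGroup.prod_diag_eq_one (D : SpecialLinearGroup (Fin n) R)
    (hD : ∀ i j, i ≠ j → D i j = 0) : ∏ i, D i i = 1 := by
  have hdiag : (D : Matrix (Fin n) (Fin n) R) = diagonal fun i ↦ D i i := by
    ext i j
    rcases eq_or_ne i j with rfl | h
    · simp
    · simp [h, hD i j h]
  rw [← det_diagonal, ← hdiag, D.det_coe]

/-- A diagonal matrix of determinant `1` whose entries outside `insert k s` are `1` is a product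
of at most `4 * #s` elementary transvections. -/
lemma isProductOfElemTransvections_of_diagonal (k : Fin n) (s : Finset (Fin n)) (hk : k ∉ s)
    (D : SpecialLinearGroup (Fin n) R) (hD : ∀ i j, i ≠ j → D i j = 0)
    (hone : ∀ i, i ∉ s → i ≠ k → D i i = 1) :
    IsProductOfElemTransvections D (4 * s.card) := by
  induction s using Finset.induction_on generalizing D with
  | empty =>
    have hdet := D.prod_diag_eq_one hD
    rw [Finset.prod_eq_single k (fun i _ hi ↦ hone i (by simp) hi) (by simp)] at hdet
    have : D = 1 := by
      ext i j
      rcases eq_or_ne i j with rfl | h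
      · by_cases hi : i = k
        · simpa [hi] using hdet
        · simpa using hone i (by simp) hi
      · simpa [h] using hD i j h
    exact this ▸ .one _
  | insert a s ha ih =>
    have hka : a ≠ k := fun h ↦ hk (h ▸ Finset.mem_insert_self _ _)
    have hunit : IsUnit (D a a) :=
      isUnit_of_dvd_one ((Finset.dvd_prod_of_mem (fun i ↦ D i i) (Finset.mem_univ a)).trans
        (D.prod_diag_eq_one hD).dvd)
    obtain ⟨v, huv⟩ := hunit.exists_right_inv
    set u := D a a with hu
    let H : SpecialLinearGroup (Fin n) R :=
      elemTransvection k a hka.symm (-(v * (v - 1))) * elemTransvection a k hka (-u) *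
        elemTransvection k a hka.symm (v - 1) * elemTransvection a k hka 1
    let K : SpecialLinearGroup (Fin n) R :=
      elemTransvection k a hka.symm (-(u * (u - 1))) * elemTransvection a k hka (-v) *
        elemTransvection k a hka.symm (u - 1) * elemTransvection a k hka 1
    have hH : (H : Matrix (Fin n) (Fin n) R) =
        diagonal (fun i ↦ if i = a then u else if i = k then v else 1) :=
      transvection_mul_eq_diagonal hka huv
    have hK : (K : Matrix (Fin n) (Fin n) R) =
        diagonal (fun i ↦ if i = a then v else if i = k then u else 1) :=
      transvection_mul_eq_diagonal hka (mul_comm u v ▸ huv)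
    have hHK : H * K = 1 := by
      ext i j
      simp only [Matrix.SpecialLinearGroup.coe_mul, hH, hK, diagonal_mul_diagonal,
        Matrix.SpecialLinearGroup.coe_one, diagonal_apply, one_apply]
      split_ifs <;> simp [huv, mul_comm v u]
    have hprod : D = H * (K * D) := by rw [← mul_assoc, hHK, one_mul]
    have hKD : ∀ i j, (K * D) i j = (if i = a then v else if i = k then u else 1) * D i j := by
      intro i j
      rw [Matrix.SpecialLinearGroup.coe_mul, hK, diagonal_mul]
    have hH4 : IsProductOfElemTransvections H 4 :=
      (((IsProductOfElemTransvections.elemTransvection _ _).mul (.elemTransvection _ _)).mul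
        (.elemTransvection _ _)).mul (.elemTransvection _ _)
    rw [Finset.card_insert_of_notMem ha, mul_add, mul_one, add_comm, hprod]
    refine hH4.mul (ih (fun h ↦ hk (Finset.mem_insert_of_mem h)) _ (fun i j hij ↦ ?_)
      fun i hi hik ↦ ?_)
    · rw [hKD, hD i j hij, mul_zero]
    · rw [hKD]
      by_cases h : i = a
      · subst h
        simpa [mul_comm v, ← hu] using huv
      · simpa [h, hik] using hone i (by simp [h, hi]) hik

end

/-- Let `R` be a commutative ring and `n ≥ 2`. If `g ∈ SL(n, R)` admits
a factorization `g = L * D * U` with `L` lower unitriangular, `D` diagonal, and `U` upper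
unitriangular (all in `SL(n, R)`), then `g` is a product of at most
`n * (n - 1) + 4 * (n - 1)` elementary transvections. -/
theorem ldu_isProductOfElemTransvections
    {R : Type*} [CommRing R] {n : ℕ} (hn : 2 ≤ n)
    (g L D U : Matrix.SpecialLinearGroup (Fin n) R)
    (hL : (∀ i, (L : Matrix (Fin n) (Fin n) R) i i = 1) ∧
      ∀ i j : Fin n, i < j → (L : Matrix (Fin n) (Fin n) R) i j = 0)
    (hD : ∀ i j : Fin n, i ≠ j → (D : Matrix (Fin n) (Fin n) R) i j = 0)
    (hU : (∀ i, (U : Matrix (Fin n) (Fin n) R) i i = 1) ∧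
      ∀ i j : Fin n, j < i → (U : Matrix (Fin n) (Fin n) R) i j = 0)
    (hg : g = L * D * U) :
    IsProductOfElemTransvections g (n * (n - 1) + 4 * (n - 1)) := by
  have hcard : (Finset.univ.filter fun p : Fin n × Fin n ↦ p.2 < p.1).card +
      (Finset.univ.filter fun p : Fin n × Fin n ↦ p.1 < p.2).card = n * (n - 1) := by
    rw [← Finset.card_union_of_disjoint (Finset.disjoint_filter.2 fun p _ h ↦ h.not_gt),
      ← Finset.filter_or]
    have : (Finset.univ.filter fun p : Fin n × Fin n ↦ p.2 < p.1 ∨ p.1 < p.2) =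
        (Finset.univ : Finset (Fin n)).offDiag := by
      ext p
      simp [or_comm]
    rw [this, Finset.offDiag_card, Finset.card_univ, Fintype.card_fin, Nat.mul_sub_one]
  have hLprod := isProductOfElemTransvections_of_unitriangular OrderDual.toDual
    (Finset.univ.filter fun p : Fin n × Fin n ↦ p.2 < p.1) (by simp) L hL.1
    fun i j hij hmem ↦ hL.2 i j (lt_of_le_of_ne (by simpa using hmem) hij)
  have hUprod := isProductOfElemTransvections_of_unitriangular id
    (Finset.univ.filter fun p : Fin n × Fin n ↦ p.1 < p.2) (by simp) U hU.1
    fun i j hij hmem ↦ hU.2 i j (lt_of_le_of_ne (by simpa using hmem) hij.symm)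
  have hDprod := isProductOfElemTransvections_of_diagonal ⟨0, by lia⟩
    (Finset.univ.erase (⟨0, by lia⟩ : Fin n)) (by simp) D hD
    fun i hi hi0 ↦ absurd (by simpa using hi) hi0
  rw [Finset.card_erase_of_mem (Finset.mem_univ _), Finset.card_univ, Fintype.card_fin] at hDprod
  rw [hg, ← hcard, add_right_comm]
  exact (hLprod.mul hDprod).mul hUprod
end

section
/- Let R be a commutative ring, n ≥ 3, and let Eₙ(R) ⊆ SL(n, R) be the elementary subgroup, i.e. the subgroup generated by all elementary transvections eᵢⱼ(t), i ≠ j, t ∈ R. If N is a normal subgroup of Eₙ(R), then the set 𝔞 = { t ∈ R : e₁₂(t) ∈ N } is an ideal of R. -/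
theorem elemTransvection_zero {n : ℕ} {R : Type*} [CommRing R] {i j : Fin n} (hij : i ≠ j) :
    elemTransvection i j hij (0 : R) = 1 :=
  Subtype.ext (Matrix.transvection_zero i j)

theorem elemTransvection_add {n : ℕ} {R : Type*} [CommRing R] {i j : Fin n} (hij : i ≠ j)
    (s t : R) :
    elemTransvection i j hij (s + t) = elemTransvection i j hij s * elemTransvection i j hij t :=
  Subtype.ext (Matrix.transvection_mul_transvection_same i j hij s t).symm

theorem elemTransvection_inv {n : ℕ} {R : Type*} [CommRing R] {i j : Fin n} (hij : i ≠ j)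
    (t : R) : (elemTransvection i j hij t)⁻¹ = elemTransvection i j hij (-t) :=
  inv_eq_of_mul_eq_one_right <| by
    rw [← elemTransvection_add, add_neg_cancel, elemTransvection_zero]

open scoped commutatorElement in
/-- The Steinberg commutator relation `[eᵢⱼ(s), eⱼₖ(t)] = eᵢₖ(st)`. -/
theorem commutatorElement_elemTransvection {n : ℕ} {R : Type*} [CommRing R] {i j k : Fin n}
    (hij : i ≠ j) (hjk : j ≠ k) (hik : i ≠ k) (s t : R) :
    ⁅elemTransvection i j hij s, elemTransvection j k hjk t⁆ =
      elemTransvection i k hik (s * t) := by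
  rw [commutatorElement_def, elemTransvection_inv, elemTransvection_inv]
  apply Subtype.ext
  change Matrix.transvection i j s * Matrix.transvection j k t * Matrix.transvection i j (-s) *
    Matrix.transvection j k (-t) = Matrix.transvection i k (s * t)
  simp only [Matrix.transvection, ← Matrix.single_neg]
  simp [mul_add, add_mul, hij.symm, hjk.symm, hik.symm]
  abel

open scoped commutatorElement in
/-- A subgroup normal in `E` contains the commutators of its elements with elements of `E`. -/
theorem Subgroup.commutatorElement_mem_of_normal_subgroupOf {G : Type*} [Group G]
    {N E : Subgroup G} (hNE : N ≤ E) (hnorm : (N.subgroupOf E).Normal) {x g : G} (hx : x ∈ N)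
    (hg : g ∈ E) : ⁅x, g⁆ ∈ N := by
  have h : g * x⁻¹ * g⁻¹ ∈ N :=
    hnorm.conj_mem ⟨x⁻¹, hNE (N.inv_mem hx)⟩ (N.inv_mem hx) ⟨g, hg⟩
  rw [commutatorElement_def]
  simpa only [mul_assoc] using N.mul_mem hx h

/-- Let `R` be a commutative ring, `n ≥ 3`, and `Eₙ(R) ⊆ SL(n, R)` the
elementary subgroup. If `N` is a normal subgroup of `Eₙ(R)`, then the set
`{t ∈ R : e₁₂(t) ∈ N}` is an ideal of `R`. -/
theorem level_set_is_ideal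
    {R : Type*} [CommRing R] {n : ℕ} (hn : 3 ≤ n)
    (E : Subgroup (Matrix.SpecialLinearGroup (Fin n) R))
    (hE : E = Subgroup.closure
      {x | ∃ (i j : Fin n) (hij : i ≠ j) (t : R), x = elemTransvection i j hij t})
    (N : Subgroup (Matrix.SpecialLinearGroup (Fin n) R)) (hNE : N ≤ E)
    (hnorm : (N.subgroupOf E).Normal) :
    ∃ 𝔞 : Ideal R, (𝔞 : Set R) =
      {t : R | elemTransvection (⟨0, by omega⟩ : Fin n) (⟨1, by omega⟩ : Fin n)
        (Fin.ne_of_val_ne (by simp)) t ∈ N} := by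
  have hmem {i j : Fin n} (hij : i ≠ j) (t : R) : elemTransvection i j hij t ∈ E :=
    hE ▸ Subgroup.subset_closure ⟨i, j, hij, t, rfl⟩
  have h01 : (⟨0, by omega⟩ : Fin n) ≠ ⟨1, by omega⟩ := by simp
  have h12 : (⟨1, by omega⟩ : Fin n) ≠ ⟨2, by omega⟩ := by simp
  have h02 : (⟨0, by omega⟩ : Fin n) ≠ ⟨2, by omega⟩ := by simp
  refine ⟨{ carrier := {t | elemTransvection _ _ h01 t ∈ N}
            zero_mem' := ?_
            add_mem' := ?_
            smul_mem' := ?_ }, rfl⟩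
  · intro s t hs ht
    rw [Set.mem_ofPred_eq, elemTransvection_add]
    exact N.mul_mem hs ht
  · rw [Set.mem_ofPred_eq, elemTransvection_zero]
    exact N.one_mem
  · intro a t ht
    have h := Subgroup.commutatorElement_mem_of_normal_subgroupOf hNE hnorm ht (hmem h12 a)
    rw [commutatorElement_elemTransvection h01 h12 h02] at h
    have h' := Subgroup.commutatorElement_mem_of_normal_subgroupOf hNE hnorm h (hmem h12.symm 1)
    rw [commutatorElement_elemTransvection h02 h12.symm h01, mul_one, mul_comm] at h'
    exact h'
end
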